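/- arXiv:2406.16856 — 6 statements merged into one kernel-verified Lean document; each statement's English description precedes it below -/
import Mathlib

section
/- Let e ≥ 3, θ > 1, λ > 1 and ζ ≥ 0 be real numbers with λ ≥ ζ and 2θ ≥ λ + ζ. Define F on rectangles (axis-parallel rectangles contained in the unit square, so with side lengths ≤ 1) by F(□) = (a·b)^θ if E(□) ≤ e and F(□) = a^λ·b^ζ if E(□) > e, where a ≥ b > 0 are the side lengths of □ and E(□) = a/b is its eccentricity. Then there exists L ∈ (0,1), depending only on θ, λ, ζ, such that F(□_A) + F(□_B) ≤ L·F(□) for every balanced two-element partition {□_A, □_B} of any rectangle □. If furthermore ζ > 0, then F(□) → 0 as the area |□| = a·b tends to 0; that is, F is a subcontrol. -/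
/-- The eccentricity of a rectangle with side lengths `w` and `h`: the ratio of the longer side
to the shorter side. -/
noncomputable def ecc (w h : ℝ) : ℝ := max w h / min w h

/-- The function `F` on rectangles: `F(□) = (a·b)^θ` if `E(□) ≤ e` and `F(□) = a^λ·b^ζ` if
`E(□) > e`, where `a ≥ b` are the side lengths and `E(□) = a/b` is the eccentricity. -/
noncomputable def Fsub (e θ lam ζ : ℝ) (w h : ℝ) : ℝ :=
  if ecc w h ≤ e then (max w h * min w h) ^ θ else (max w h) ^ lam * (min w h) ^ ζ

/-- `{□_A, □_B}` (with side lengths `(wA, hA)` and `(wB, hB)`) is a balanced two-element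
partition of the rectangle `□` with side lengths `(w, h)`: it is either a vertical or a
horizontal cut, and `max(E(□_A), E(□_B)) ≤ max(3, 2·E(□)/3)`. -/
def IsBalancedSplit (w h wA hA wB hB : ℝ) : Prop :=
  (0 < wA ∧ 0 < hA ∧ 0 < wB ∧ 0 < hB) ∧
  ((wA + wB = w ∧ hA = h ∧ hB = h) ∨ (hA + hB = h ∧ wA = w ∧ wB = w)) ∧
  max (ecc wA hA) (ecc wB hB) ≤ max 3 (2 * ecc w h / 3)

lemma ecc_comm (w h : ℝ) : ecc w h = ecc h w := by
  simp only [ecc, max_comm, min_comm]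

lemma Fsub_comm (e θ lam ζ w h : ℝ) : Fsub e θ lam ζ w h = Fsub e θ lam ζ h w := by
  simp only [Fsub, ecc_comm w h, max_comm w h, min_comm w h]

lemma ecc_le_iff {w h M : ℝ} (hw : 0 < w) (hh : 0 < h) :
    ecc w h ≤ M ↔ w ≤ M * h ∧ h ≤ M * w := by
  unfold ecc
  rcases le_total w h with hwh | hwh
  · rw [max_eq_right hwh, min_eq_left hwh, div_le_iff₀ hw]
    refine ⟨fun hM => ⟨?_, hM⟩, fun hM => hM.2⟩
    have : 1 ≤ M := by by_contra! hlt; nlinarith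
    nlinarith
  · rw [max_eq_left hwh, min_eq_right hwh, div_le_iff₀ hh]
    refine ⟨fun hM => ⟨hM, ?_⟩, fun hM => hM.1⟩
    have : 1 ≤ M := by by_contra! hlt; nlinarith
    nlinarith

lemma Fsub_of_ecc_le {e θ lam ζ w h : ℝ} (he : ecc w h ≤ e) :
    Fsub e θ lam ζ w h = (w * h) ^ θ := by
  rw [Fsub, if_pos he, max_mul_min]

/-- On the unit square, the low-eccentricity formula for `F` is dominated by the other one. -/
lemma mul_rpow_le_rpow_mul_rpow {θ lam ζ a b : ℝ} (hζlam : ζ ≤ lam) (hsum : lam + ζ ≤ 2 * θ)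
    (hb : 0 < b) (hba : b ≤ a) (ha1 : a ≤ 1) : (a * b) ^ θ ≤ a ^ lam * b ^ ζ := by
  have ha : 0 < a := hb.trans_le hba
  calc (a * b) ^ θ = a ^ θ * (b ^ (θ - ζ) * b ^ ζ) := by
        rw [Real.mul_rpow ha.le hb.le, ← Real.rpow_add hb, sub_add_cancel]
    _ ≤ a ^ θ * (a ^ (θ - ζ) * b ^ ζ) := by
        gcongr
        linarith
    _ = a ^ (2 * θ - ζ) * b ^ ζ := by
        rw [← mul_assoc, ← Real.rpow_add ha]; ring_nf
    _ ≤ a ^ lam * b ^ ζ := by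
        gcongr ?_ * _
        exact Real.rpow_le_rpow_of_exponent_ge ha ha1 (by linarith)

lemma Fsub_le {e θ lam ζ w h : ℝ} (hζlam : ζ ≤ lam) (hsum : lam + ζ ≤ 2 * θ)
    (hw : 0 < w) (hh : 0 < h) (hw1 : w ≤ 1) (hh1 : h ≤ 1) :
    Fsub e θ lam ζ w h ≤ (max w h) ^ lam * (min w h) ^ ζ := by
  unfold Fsub
  split_ifs
  · exact mul_rpow_le_rpow_mul_rpow hζlam hsum (lt_min hw hh) min_le_max (max_le hw1 hh1)
  · exact le_rfl

lemma mul_rpow_le_Fsub {e θ lam ζ w h : ℝ} (hζlam : ζ ≤ lam) (hsum : lam + ζ ≤ 2 * θ)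
    (hw : 0 < w) (hh : 0 < h) (hw1 : w ≤ 1) (hh1 : h ≤ 1) :
    (w * h) ^ θ ≤ Fsub e θ lam ζ w h := by
  unfold Fsub
  rw [← max_mul_min w h]
  split_ifs
  · exact le_rfl
  · exact mul_rpow_le_rpow_mul_rpow hζlam hsum (lt_min hw hh) min_le_max (max_le hw1 hh1)

lemma rpow_add_rpow_le {u v c p : ℝ} (hu : 0 < u) (hv : 0 < v) (hp : 1 ≤ p)
    (huc : u ≤ c * (u + v)) (hvc : v ≤ c * (u + v)) :
    u ^ p + v ^ p ≤ c ^ (p - 1) * (u + v) ^ p := by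
  have hc : 0 < c := pos_of_mul_pos_left (hu.trans_le huc) (by positivity)
  have key : ∀ x : ℝ, 0 < x → x ^ p = x * x ^ (p - 1) := fun x hx => by
    rw [← Real.rpow_one_add' hx.le (by linarith), add_sub_cancel]
  calc u ^ p + v ^ p = u * u ^ (p - 1) + v * v ^ (p - 1) := by rw [key u hu, key v hv]
    _ ≤ u * (c * (u + v)) ^ (p - 1) + v * (c * (u + v)) ^ (p - 1) := by
        have : 0 ≤ p - 1 := by linarith
        gcongr
    _ = c ^ (p - 1) * (u + v) ^ p := by
        rw [Real.mul_rpow hc.le (by positivity), key (u + v) (by positivity)]; ring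

/-- In a balanced cut of one side, either both pieces have eccentricity at most `3`, or the side
cut is the longer one and both pieces are longer than the other side. -/
lemma balanced_cut_cases {u v h : ℝ} (hu : 0 < u) (hv : 0 < v) (hh : 0 < h)
    (hA : ecc u h ≤ max 3 (2 * ecc (u + v) h / 3))
    (hB : ecc v h ≤ max 3 (2 * ecc (u + v) h / 3)) :
    (u ≤ 9 / 10 * (u + v) ∧ v ≤ 9 / 10 * (u + v)) ∧
      ((ecc u h ≤ 3 ∧ ecc v h ≤ 3) ∨ (h ≤ u ∧ h ≤ v)) := by
  rcases le_total (2 * ecc (u + v) h / 3) 3 with hE | hE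
  · rw [max_eq_left hE] at hA hB
    refine ⟨?_, Or.inl ⟨hA, hB⟩⟩
    rw [ecc_le_iff hu hh] at hA
    rw [ecc_le_iff hv hh] at hB
    constructor <;> linarith [hA.1, hA.2, hB.1, hB.2]
  · rw [max_eq_right hE, ecc_le_iff hu hh] at hA
    rw [max_eq_right hE, ecc_le_iff hv hh] at hB
    have hmul : ecc (u + v) h * min (u + v) h = max (u + v) h :=
      div_mul_cancel₀ _ (lt_min (by positivity) hh).ne'
    rcases le_total (u + v) h with hle | hle
    · rw [max_eq_right hle, min_eq_left hle] at hmul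
      nlinarith [hA.2]
    · rw [max_eq_left hle, min_eq_right hle] at hmul
      have hu' : u ≤ 2 / 3 * (u + v) := by linarith [hA.1]
      have hv' : v ≤ 2 / 3 * (u + v) := by linarith [hB.1]
      refine ⟨⟨by linarith, by linarith⟩, Or.inr ?_⟩
      constructor <;> nlinarith

lemma Fsub_add_Fsub_le_of_balanced_cut {e θ lam ζ u v h : ℝ} (hθ : 1 < θ) (hlam : 1 < lam)
    (hζlam : ζ ≤ lam) (hsum : lam + ζ ≤ 2 * θ) (he : 3 ≤ e)
    (hu : 0 < u) (hv : 0 < v) (hh : 0 < h) (hw1 : u + v ≤ 1) (hh1 : h ≤ 1)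
    (hA : ecc u h ≤ max 3 (2 * ecc (u + v) h / 3))
    (hB : ecc v h ≤ max 3 (2 * ecc (u + v) h / 3)) :
    Fsub e θ lam ζ u h + Fsub e θ lam ζ v h ≤
      (9 / 10 : ℝ) ^ (min θ lam - 1) * Fsub e θ lam ζ (u + v) h := by
  obtain ⟨⟨hu9, hv9⟩, hcases⟩ := balanced_cut_cases hu hv hh hA hB
  have hw : 0 < u + v := by positivity
  have hlow : ecc u h ≤ e → ecc v h ≤ e → Fsub e θ lam ζ u h + Fsub e θ lam ζ v h ≤
      (9 / 10 : ℝ) ^ (min θ lam - 1) * Fsub e θ lam ζ (u + v) h := fun hue hve => by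
    rw [Fsub_of_ecc_le hue, Fsub_of_ecc_le hve]
    calc (u * h) ^ θ + (v * h) ^ θ
        ≤ (9 / 10 : ℝ) ^ (θ - 1) * (u * h + v * h) ^ θ :=
          rpow_add_rpow_le (by positivity) (by positivity) hθ.le (by nlinarith) (by nlinarith)
      _ ≤ (9 / 10 : ℝ) ^ (min θ lam - 1) * ((u + v) * h) ^ θ := by
          rw [← add_mul]
          gcongr ?_ * _
          exact Real.rpow_le_rpow_of_exponent_ge (by norm_num) (by norm_num)
            (by linarith [min_le_left θ lam])
      _ ≤ _ := by
          gcongr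
          exact mul_rpow_le_Fsub hζlam hsum hw hh hw1 hh1
  by_cases hE : ecc (u + v) h ≤ e
  · have hM : max 3 (2 * ecc (u + v) h / 3) ≤ e := max_le he (by linarith)
    exact hlow (hA.trans hM) (hB.trans hM)
  rcases hcases with ⟨hu3, hv3⟩ | ⟨hhu, hhv⟩
  · exact hlow (hu3.trans he) (hv3.trans he)
  have hFu := Fsub_le (e := e) hζlam hsum hu hh (by linarith) hh1
  have hFv := Fsub_le (e := e) hζlam hsum hv hh (by linarith) hh1
  rw [max_eq_left hhu, min_eq_right hhu] at hFu
  rw [max_eq_left hhv, min_eq_right hhv] at hFv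
  have hhw : h ≤ u + v := by linarith
  rw [Fsub.eq_1 e θ lam ζ (u + v) h, if_neg hE, max_eq_left hhw, min_eq_right hhw]
  calc Fsub e θ lam ζ u h + Fsub e θ lam ζ v h
      ≤ (u ^ lam + v ^ lam) * h ^ ζ := by linarith
    _ ≤ ((9 / 10 : ℝ) ^ (lam - 1) * (u + v) ^ lam) * h ^ ζ := by
        gcongr
        exact rpow_add_rpow_le hu hv hlam.le hu9 hv9
    _ ≤ ((9 / 10 : ℝ) ^ (min θ lam - 1) * (u + v) ^ lam) * h ^ ζ := by
        gcongr ?_ * _ * _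
        exact Real.rpow_le_rpow_of_exponent_ge (by norm_num) (by norm_num)
          (by linarith [min_le_right θ lam])
    _ = _ := by ring

lemma Fsub_le_area_rpow {e θ lam ζ w h : ℝ} (hζlam : ζ ≤ lam) (hsum : lam + ζ ≤ 2 * θ)
    (hw : 0 < w) (hh : 0 < h) (hw1 : w ≤ 1) (hh1 : h ≤ 1) :
    Fsub e θ lam ζ w h ≤ (w * h) ^ ζ := by
  have hmin : 0 < min w h := lt_min hw hh
  have hmax : 0 < max w h := lt_max_of_lt_left hw
  calc Fsub e θ lam ζ w h ≤ (max w h) ^ lam * (min w h) ^ ζ := Fsub_le hζlam hsum hw hh hw1 hh1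
    _ ≤ (max w h) ^ ζ * (min w h) ^ ζ := by
        gcongr ?_ * _
        exact Real.rpow_le_rpow_of_exponent_ge hmax (max_le hw1 hh1) hζlam
    _ = (w * h) ^ ζ := by rw [← Real.mul_rpow hmax.le hmin.le, max_mul_min]

/-- Let `e ≥ 3`, `θ > 1`, `λ > 1`, `ζ ≥ 0` with `λ ≥ ζ` and `2θ ≥ λ + ζ`.  Then there is
`L ∈ (0,1)`, depending only on `θ, λ, ζ`, such that `F(□_A) + F(□_B) ≤ L·F(□)` for every
balanced partition `{□_A, □_B}` of a rectangle `□` contained in the unit square; and if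
moreover `ζ > 0` then `F(□) → 0` as the area `|□| → 0`, i.e. `F` is a subcontrol. -/
theorem F_is_subcontrol (θ lam ζ : ℝ) (hθ : 1 < θ) (hlam : 1 < lam)
    (hζ : 0 ≤ ζ) (hζlam : ζ ≤ lam) (hsum : lam + ζ ≤ 2 * θ) :
    (∃ L : ℝ, 0 < L ∧ L < 1 ∧ ∀ e : ℝ, 3 ≤ e →
      ∀ w h wA hA wB hB : ℝ, 0 < w → 0 < h → w ≤ 1 → h ≤ 1 →
        IsBalancedSplit w h wA hA wB hB →
        Fsub e θ lam ζ wA hA + Fsub e θ lam ζ wB hB ≤ L * Fsub e θ lam ζ w h) ∧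
    (0 < ζ → ∀ e : ℝ, 3 ≤ e → ∀ ε : ℝ, 0 < ε → ∃ η : ℝ, 0 < η ∧
      ∀ w h : ℝ, 0 < w → 0 < h → w ≤ 1 → h ≤ 1 → w * h < η →
        Fsub e θ lam ζ w h < ε) := by
  constructor
  · have hp : 1 < min θ lam := lt_min hθ hlam
    refine ⟨(9 / 10 : ℝ) ^ (min θ lam - 1), by positivity,
      Real.rpow_lt_one (by norm_num) (by norm_num) (by linarith), ?_⟩
    rintro e he w h wA hA wB hB hw hh hw1 hh1 ⟨⟨hwA, hhA, hwB, hhB⟩, hcut, hmax⟩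
    obtain ⟨hmaxA, hmaxB⟩ := max_le_iff.1 hmax
    rcases hcut with ⟨rfl, rfl, rfl⟩ | ⟨rfl, rfl, rfl⟩
    · exact Fsub_add_Fsub_le_of_balanced_cut hθ hlam hζlam hsum he hwA hwB hh hw1 hh1 hmaxA hmaxB
    · simp only [ecc_comm wB] at hmaxA hmaxB
      simp only [Fsub_comm e θ lam ζ wB]
      exact Fsub_add_Fsub_le_of_balanced_cut hθ hlam hζlam hsum he hhA hhB hw hh1 hw1 hmaxA hmaxB
  · intro hζpos e _ ε hε
    refine ⟨ε ^ ζ⁻¹, by positivity, fun w h hw hh hw1 hh1 harea => ?_⟩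
    calc Fsub e θ lam ζ w h ≤ (w * h) ^ ζ := Fsub_le_area_rpow hζlam hsum hw hh hw1 hh1
      _ < (ε ^ ζ⁻¹) ^ ζ := by gcongr
      _ = ε := Real.rpow_inv_rpow hε.le hζpos.ne'
end

section
/- Let □ be a rectangle with width w and height h satisfying w > h and w/h ≥ 9/2 (so its eccentricity E(□) = w/h is at least 9/2). Then every balanced two-element partition {□_A, □_B} of □ is formed by a vertical cut; moreover, if w_A and w_B denote the widths of □_A and □_B (both of height h), then w_A/w ∈ [1/3, 2/3] and w_B/w ∈ [1/3, 2/3], and w_A > h and w_B > h. -/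
theorem div_le_ecc {x y : ℝ} (hx : 0 < x) (hy : 0 < y) : x / y ≤ ecc x y :=
  div_le_div₀ (hx.le.trans (le_max_left x y)) (le_max_left x y) (lt_min hx hy) (min_le_right x y)

/-- If a rectangle has `w > h` and eccentricity `w/h ≥ 9/2`, then every balanced partition of it
is a vertical cut, the widths of the two parts satisfy `wA/w, wB/w ∈ [1/3, 2/3]`, and both parts
are wider than they are tall. -/
theorem balanced_partition_of_long_rectangle
    (w h wA hA wB hB : ℝ) (hh : 0 < h) (hwh : h < w) (hE : 9 / 2 ≤ w / h)
    (hbal : IsBalancedSplit w h wA hA wB hB) :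
    (wA + wB = w ∧ hA = h ∧ hB = h) ∧
    (1 / 3 ≤ wA / w ∧ wA / w ≤ 2 / 3) ∧ (1 / 3 ≤ wB / w ∧ wB / w ≤ 2 / 3) ∧
    h < wA ∧ h < wB := by
  obtain ⟨⟨hwA, hhA, hwB, hhB⟩, hcut, hmax⟩ := hbal
  have hw : 0 < w := hh.trans hwh
  have hecc : ecc w h = w / h := by simp [ecc, max_eq_left hwh.le, min_eq_right hwh.le]
  rw [hecc, max_eq_right (a := (3 : ℝ)) (by linarith)] at hmax
  have hboundA := (div_le_ecc hwA hhA).trans ((le_max_left _ _).trans hmax)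
  have hboundB := (div_le_ecc hwB hhB).trans ((le_max_right _ _).trans hmax)
  have hlong : 9 / 2 * h ≤ w := (le_div_iff₀ hh).mp hE
  rcases hcut with ⟨hsum, rfl, rfl⟩ | ⟨hsum, rfl, rfl⟩
  · have hwA' : wA ≤ 2 * w / 3 := by
      rwa [mul_div_assoc', div_right_comm, div_le_div_iff_of_pos_right hh] at hboundA
    have hwB' : wB ≤ 2 * w / 3 := by
      rwa [mul_div_assoc', div_right_comm, div_le_div_iff_of_pos_right hh] at hboundB
    refine ⟨⟨hsum, rfl, rfl⟩, ⟨?_, ?_⟩, ⟨?_, ?_⟩, ?_, ?_⟩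
    · rw [le_div_iff₀ hw]; linarith
    · rw [div_le_iff₀ hw]; linarith
    · rw [le_div_iff₀ hw]; linarith
    · rw [div_le_iff₀ hw]; linarith
    · linarith
    · linarith
  · have hlt : wB / h < wB / hA := div_lt_div_of_pos_left hw hhA (by linarith)
    have hpos : 0 < wB / h := div_pos hw hh
    linarith
end

section
/- Let (t : 𝔢 → 𝔤, ρ) be a differential precrossed module of Lie algebras over a field k, and let 𝔭 ⊆ 𝔢 be the Lie ideal generated by the set of all Peiffer commutators {⟪a,b⟫ := ρ_{t(a)}(b) − ⁅a,b⁆ : a, b ∈ 𝔢}. Then 𝔭 is contained in the kernel of t, and 𝔭 is invariant under the action: ρ_z(𝔭) ⊆ 𝔭 for every z ∈ 𝔤. -/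
/-- The Peiffer commutator of `a, b` in a differential precrossed module
`(t : 𝔢 → 𝔤, ρ)` is `⟪a,b⟫ := ρ_{t a}(b) − ⁅a,b⁆`. -/
def peifferCommutator {k E G : Type*} [CommRing k]
    [LieRing E] [LieAlgebra k E] [LieRing G] [LieAlgebra k G]
    (t : E →ₗ⁅k⁆ G) (ρ : G →ₗ⁅k⁆ LieDerivation k E E) (a b : E) : E :=
  (ρ (t a)) b - ⁅a, b⁆

/-- The Lie ideal of `𝔢` generated by all Peiffer commutators. -/
def peifferIdeal {k E G : Type*} [CommRing k]
    [LieRing E] [LieAlgebra k E] [LieRing G] [LieAlgebra k G]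
    (t : E →ₗ⁅k⁆ G) (ρ : G →ₗ⁅k⁆ LieDerivation k E E) : LieIdeal k E :=
  LieSubmodule.lieSpan k E {y : E | ∃ a b : E, y = peifferCommutator t ρ a b}

/-- A derivation that maps a set into the Lie ideal it generates preserves that ideal. -/
theorem LieDerivation.apply_mem_lieSpan {R L : Type*} [CommRing R] [LieRing L] [LieAlgebra R L]
    (D : LieDerivation R L L) {s : Set L} (hs : ∀ y ∈ s, D y ∈ LieSubmodule.lieSpan R L s)
    {x : L} (hx : x ∈ LieSubmodule.lieSpan R L s) : D x ∈ LieSubmodule.lieSpan R L s := by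
  set I : LieIdeal R L := LieSubmodule.lieSpan R L s
  let J : LieIdeal R L :=
    { (I : Submodule R L) ⊓ (I : Submodule R L).comap (D : L →ₗ[R] L) with
      lie_mem := by
        rintro y m ⟨hm, hDm⟩
        refine ⟨lie_mem_right R L I y m hm, ?_⟩
        change D ⁅y, m⁆ ∈ I
        rw [LieDerivation.apply_lie_eq_add]
        exact add_mem (lie_mem_right R L I y _ hDm) (lie_mem_right R L I _ m hm) }
  have hIJ : I ≤ J :=
    LieSubmodule.lieSpan_le.2 fun y hy => ⟨LieSubmodule.subset_lieSpan hy, hs y hy⟩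
  exact (hIJ hx).2

/-- The feedback map kills Peiffer commutators. -/
theorem map_peifferCommutator {k E G : Type*} [CommRing k]
    [LieRing E] [LieAlgebra k E] [LieRing G] [LieAlgebra k G]
    (t : E →ₗ⁅k⁆ G) (ρ : G →ₗ⁅k⁆ LieDerivation k E E)
    (hequiv : ∀ (x : G) (a : E), t ((ρ x) a) = ⁅x, t a⁆) (a b : E) :
    t (peifferCommutator t ρ a b) = 0 := by
  rw [peifferCommutator, map_sub, hequiv, LieHom.map_lie, sub_self]

/-- The action satisfies the Leibniz rule for Peiffer commutators. -/
theorem action_peifferCommutator {k E G : Type*} [CommRing k]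
    [LieRing E] [LieAlgebra k E] [LieRing G] [LieAlgebra k G]
    (t : E →ₗ⁅k⁆ G) (ρ : G →ₗ⁅k⁆ LieDerivation k E E)
    (hequiv : ∀ (x : G) (a : E), t ((ρ x) a) = ⁅x, t a⁆) (z : G) (a b : E) :
    ρ z (peifferCommutator t ρ a b) =
      peifferCommutator t ρ (ρ z a) b + peifferCommutator t ρ a (ρ z b) := by
  simp only [peifferCommutator, hequiv, LieHom.map_lie, LieDerivation.lie_apply, map_sub,
    LieDerivation.apply_lie_eq_add]
  abel

/-- In a differential precrossed module of Lie algebras over a field `k`, the Lie ideal `𝔭`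
generated by the Peiffer commutators is contained in the kernel of the feedback `t`, and it is
invariant under the action: `ρ_z(𝔭) ⊆ 𝔭` for every `z ∈ 𝔤`. -/
theorem peiffer_ideal_properties {k E G : Type*} [Field k]
    [LieRing E] [LieAlgebra k E] [LieRing G] [LieAlgebra k G]
    (t : E →ₗ⁅k⁆ G) (ρ : G →ₗ⁅k⁆ LieDerivation k E E)
    (hequiv : ∀ (x : G) (a : E), t ((ρ x) a) = ⁅x, t a⁆) :
    (∀ x ∈ peifferIdeal t ρ, t x = 0) ∧
    (∀ z : G, ∀ x ∈ peifferIdeal t ρ, (ρ z) x ∈ peifferIdeal t ρ) := by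
  refine ⟨fun x hx => ?_, fun z x hx => ?_⟩
  · have h : peifferIdeal t ρ ≤ t.ker := by
      refine LieSubmodule.lieSpan_le.2 ?_
      rintro _ ⟨a, b, rfl⟩
      exact LieHom.mem_ker.2 (map_peifferCommutator t ρ hequiv a b)
    exact LieHom.mem_ker.1 (h hx)
  · refine LieDerivation.apply_mem_lieSpan (ρ z) ?_ hx
    rintro _ ⟨a, b, rfl⟩
    rw [action_peifferCommutator t ρ hequiv]
    exact add_mem (LieSubmodule.subset_lieSpan ⟨_, _, rfl⟩)
      (LieSubmodule.subset_lieSpan ⟨_, _, rfl⟩)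
end

section
/- Let (t : 𝔢 → 𝔤, ρ) be a differential precrossed module of Lie algebras over a field k, let 𝔭 ⊆ 𝔢 be the Lie ideal generated by the Peiffer commutators, and set 𝔥 := 𝔢/𝔭 with canonical projection π : 𝔢 → 𝔥. Then: (i) there is a unique Lie algebra homomorphism t̃ : 𝔥 → 𝔤 with t̃ ∘ π = t; (ii) for each z ∈ 𝔤 there is a unique well-defined derivation ρ̃_z of 𝔥 satisfying ρ̃_z(π(a)) = π(ρ_z(a)) for all a ∈ 𝔢, and z ↦ ρ̃_z is a Lie algebra homomorphism 𝔤 → Der(𝔥); (iii) the pair (t̃ : 𝔥 → 𝔤, ρ̃) is a differential crossed module, i.e. it satisfies both the equivariance identity t̃(ρ̃_z(h)) = ⁅z, t̃(h)⁆ for all z ∈ 𝔤, h ∈ 𝔥, and the Peiffer identity ρ̃_{t̃(h)}(h') = ⁅h, h'⁆ for all h, h' ∈ 𝔥. -/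
/-- A Lie algebra homomorphism vanishing on a Lie ideal descends to the quotient. -/
def LieIdeal.quotientLift {k E G : Type*} [CommRing k]
    [LieRing E] [LieAlgebra k E] [LieRing G] [LieAlgebra k G]
    (I : LieIdeal k E) (f : E →ₗ⁅k⁆ G) (hf : ∀ x ∈ I, f x = 0) : (E ⧸ I) →ₗ⁅k⁆ G :=
  { I.toSubmodule.liftQ (f : E →ₗ[k] G) hf with
    map_lie' := by
      intro x y
      induction x using Submodule.Quotient.induction_on
      induction y using Submodule.Quotient.induction_on
      exact f.map_lie _ _ }

/-- A Lie derivation preserving a Lie ideal descends to the quotient. -/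
def LieDerivation.quotientMap {k E : Type*} [CommRing k] [LieRing E] [LieAlgebra k E]
    (I : LieIdeal k E) (D : LieDerivation k E E) (hD : ∀ x ∈ I, D x ∈ I) :
    LieDerivation k (E ⧸ I) (E ⧸ I) :=
  { I.toSubmodule.mapQ I.toSubmodule (D : E →ₗ[k] E) hD with
    leibniz' := by
      intro x y
      induction x using Submodule.Quotient.induction_on
      induction y using Submodule.Quotient.induction_on
      exact congr_arg (LieSubmodule.Quotient.mk (N := I)) (D.apply_lie_eq_sub _ _) }

/-- An action by derivations preserving a Lie ideal descends to the quotient. -/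
def LieDerivation.quotientAction {k E G : Type*} [CommRing k]
    [LieRing E] [LieAlgebra k E] [LieRing G] [LieAlgebra k G]
    (I : LieIdeal k E) (ρ : G →ₗ⁅k⁆ LieDerivation k E E) (hρ : ∀ z, ∀ x ∈ I, ρ z x ∈ I) :
    G →ₗ⁅k⁆ LieDerivation k (E ⧸ I) (E ⧸ I) where
  toFun z := LieDerivation.quotientMap I (ρ z) (hρ z)
  map_add' z w := by
    ext x
    induction x using Submodule.Quotient.induction_on with | _ a
    exact congr_arg (LieSubmodule.Quotient.mk (N := I))
      (LieDerivation.congr_fun (map_add ρ z w) a)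
  map_smul' c z := by
    ext x
    induction x using Submodule.Quotient.induction_on with | _ a
    exact congr_arg (LieSubmodule.Quotient.mk (N := I))
      (LieDerivation.congr_fun (map_smul ρ c z) a)
  map_lie' {z w} := by
    ext x
    induction x using Submodule.Quotient.induction_on with | _ a
    exact congr_arg (LieSubmodule.Quotient.mk (N := I))
      (LieDerivation.congr_fun (ρ.map_lie z w) a)

section Peiffer

variable {k E G : Type*} [CommRing k] [LieRing E] [LieAlgebra k E] [LieRing G] [LieAlgebra k G]
  (t : E →ₗ⁅k⁆ G) (ρ : G →ₗ⁅k⁆ LieDerivation k E E)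

theorem peifferCommutator_mem_peifferIdeal (a b : E) :
    peifferCommutator t ρ a b ∈ peifferIdeal t ρ :=
  LieSubmodule.subset_lieSpan ⟨a, b, rfl⟩

variable {t ρ}

theorem peifferIdeal_le_ker (hequiv : ∀ (x : G) (a : E), t (ρ x a) = ⁅x, t a⁆) :
    peifferIdeal t ρ ≤ t.ker := by
  refine LieSubmodule.lieSpan_le.mpr ?_
  rintro _ ⟨a, b, rfl⟩
  simp [peifferCommutator, hequiv]

/-- Each `ρ z` acts on Peiffer commutators by the Leibniz rule. -/
theorem apply_peifferCommutator (hequiv : ∀ (x : G) (a : E), t (ρ x a) = ⁅x, t a⁆)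
    (z : G) (a b : E) :
    ρ z (peifferCommutator t ρ a b) =
      peifferCommutator t ρ (ρ z a) b + peifferCommutator t ρ a (ρ z b) := by
  simp only [peifferCommutator, map_sub, hequiv, LieHom.map_lie, LieDerivation.lie_apply,
    LieDerivation.apply_lie_eq_add]
  abel

theorem apply_mem_peifferIdeal (hequiv : ∀ (x : G) (a : E), t (ρ x a) = ⁅x, t a⁆)
    (z : G) {x : E} (hx : x ∈ peifferIdeal t ρ) : ρ z x ∈ peifferIdeal t ρ := by
  induction hx using LieSubmodule.lieSpan_induction with
  | mem x h =>
    obtain ⟨a, b, rfl⟩ := h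
    rw [apply_peifferCommutator hequiv]
    exact add_mem (peifferCommutator_mem_peifferIdeal t ρ _ _)
      (peifferCommutator_mem_peifferIdeal t ρ _ _)
  | zero => simp
  | add x y _ _ hx hy => rw [map_add]; exact add_mem hx hy
  | smul c x _ hx => rw [map_smul]; exact SMulMemClass.smul_mem c hx
  | lie x y hy ih =>
    rw [LieDerivation.apply_lie_eq_add]
    exact add_mem (LieSubmodule.lie_mem _ ih) (LieSubmodule.lie_mem _ hy)

end Peiffer

/-- Quotienting a differential precrossed module `(t : 𝔢 → 𝔤, ρ)` of Lie algebras by the Lie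
ideal `𝔭` generated by the Peiffer commutators yields a differential crossed module
`(t̃ : 𝔢/𝔭 → 𝔤, ρ̃)`: the feedback `t̃` and the action derivations `ρ̃_z` descend uniquely to
the quotient, and they satisfy both the equivariance and the Peiffer identities. -/
theorem quotient_is_crossed_module {k E G : Type*} [Field k]
    [LieRing E] [LieAlgebra k E] [LieRing G] [LieAlgebra k G]
    (t : E →ₗ⁅k⁆ G) (ρ : G →ₗ⁅k⁆ LieDerivation k E E)
    (hequiv : ∀ (x : G) (a : E), t ((ρ x) a) = ⁅x, t a⁆) :
    ∃ (T : (E ⧸ peifferIdeal t ρ) →ₗ⁅k⁆ G)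
      (R : G →ₗ⁅k⁆ LieDerivation k (E ⧸ peifferIdeal t ρ) (E ⧸ peifferIdeal t ρ)),
      -- (i) the feedback descends and is unique
      (∀ a : E, T (LieSubmodule.Quotient.mk (N := peifferIdeal t ρ) a) = t a) ∧
      (∀ T' : (E ⧸ peifferIdeal t ρ) →ₗ⁅k⁆ G,
        (∀ a : E, T' (LieSubmodule.Quotient.mk (N := peifferIdeal t ρ) a) = t a) → T' = T) ∧
      -- (ii) each action derivation descends and is unique, and `z ↦ ρ̃_z` is a Lie hom
      (∀ (z : G) (a : E),
        (R z) (LieSubmodule.Quotient.mk (N := peifferIdeal t ρ) a) =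
          LieSubmodule.Quotient.mk (N := peifferIdeal t ρ) ((ρ z) a)) ∧
      (∀ (z : G) (D : LieDerivation k (E ⧸ peifferIdeal t ρ) (E ⧸ peifferIdeal t ρ)),
        (∀ a : E,
          D (LieSubmodule.Quotient.mk (N := peifferIdeal t ρ) a) =
            LieSubmodule.Quotient.mk (N := peifferIdeal t ρ) ((ρ z) a)) → D = R z) ∧
      -- (iii) equivariance and Peiffer identities
      (∀ (z : G) (h : E ⧸ peifferIdeal t ρ), T ((R z) h) = ⁅z, T h⁆) ∧
      (∀ h h' : E ⧸ peifferIdeal t ρ, (R (T h)) h' = ⁅h, h'⁆) := by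
  refine ⟨LieIdeal.quotientLift _ t fun _ hx => peifferIdeal_le_ker hequiv hx,
    LieDerivation.quotientAction _ ρ fun z _ hx => apply_mem_peifferIdeal hequiv z hx,
    fun _ => rfl, fun T' hT' => ?_, fun _ _ => rfl, fun z D hD => ?_, fun z h => ?_,
    fun h h' => ?_⟩
  · ext x
    induction x using Submodule.Quotient.induction_on with | _ a
    exact hT' a
  · ext x
    induction x using Submodule.Quotient.induction_on with | _ a
    exact hD a
  · induction h using Submodule.Quotient.induction_on with | _ a
    exact hequiv z a
  · induction h using Submodule.Quotient.induction_on with | _ a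
    induction h' using Submodule.Quotient.induction_on with | _ b
    exact (Submodule.Quotient.eq (peifferIdeal t ρ).toSubmodule).mpr
      (peifferCommutator_mem_peifferIdeal t ρ a b)
end

section
/- Let L be the free Lie algebra over ℝ on generators Z_1, …, Z_n, and let W = ⁅L, L⁆ be its derived subalgebra. Let S = ⋃_{p ≥ 2} I_{n,p}, where I_{n,p} = {(i₁,…,i_p) ∈ {1,…,n}^p : i₁ ≥ i₂ ≥ … ≥ i_{p−1} < i_p}, and let Φ be the Lie algebra homomorphism from the free Lie algebra over ℝ on the set S to L determined by sending the generator (i₁,…,i_p) to the right-nested bracket B(i₁,…,i_p) = ⁅Z_{i₁}, ⁅Z_{i₂}, …, ⁅Z_{i_{p−1}}, Z_{i_p}⁆…⁆⁆. Then Φ is injective and its image equals W; that is, W is a free Lie algebra freely generated by the elements B(I) for I ∈ S. -/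
/-- The right-nested bracket `B(i₁,…,i_p) = ⁅Z_{i₁}, ⁅Z_{i₂}, …, ⁅Z_{i_{p−1}}, Z_{i_p}⁆…⁆⁆`
in the free Lie algebra over `ℝ`, for a tuple given as a list (junk value `0` on the empty
list). -/
noncomputable def nestedBracket {n : ℕ} : List (Fin n) → FreeLieAlgebra ℝ (Fin n)
  | [] => 0
  | [i] => FreeLieAlgebra.of ℝ i
  | i :: j :: rest => ⁅FreeLieAlgebra.of ℝ i, nestedBracket (j :: rest)⁆

/-- The index set `⋃_{p ≥ 2} I_{n,p}`: tuples `(i₁,…,i_p)` (encoded as lists) with `p ≥ 2`,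
`i₁ ≥ i₂ ≥ … ≥ i_{p−1}` and `i_{p−1} < i_p`. -/
def IsIdxI {n : ℕ} (l : List (Fin n)) : Prop :=
  2 ≤ l.length ∧ List.Chain' (fun a b => b ≤ a) l.dropLast ∧
  ∃ a b : Fin n, l.dropLast.getLast? = some a ∧ l.getLast? = some b ∧ a < b

namespace FreeLieAlgebra

section General

variable {R : Type*} [CommRing R] {X : Type*}

theorem induction_on {p : FreeLieAlgebra R X → Prop} (of_mem : ∀ x, p (of R x)) (zero_mem : p 0)
    (add_mem : ∀ a b, p a → p b → p (a + b)) (smul_mem : ∀ (t : R) a, p a → p (t • a))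
    (lie_mem : ∀ a b, p a → p b → p ⁅a, b⁆) (a : FreeLieAlgebra R X) : p a := by
  let S : LieSubalgebra R (FreeLieAlgebra R X) :=
    { carrier := {a | p a}
      zero_mem' := zero_mem
      add_mem' := fun {a b} ha hb => add_mem a b ha hb
      smul_mem' := fun t a ha => smul_mem t a ha
      lie_mem' := fun {a b} ha hb => lie_mem a b ha hb }
  have h : S.incl.comp (lift R fun x => (⟨of R x, of_mem x⟩ : S)) = LieHom.id := by
    ext x
    simp
  have ha := LieHom.congr_fun h a
  rw [LieHom.comp_apply, LieHom.id_apply] at ha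
  exact ha ▸ (lift R (fun x => (⟨of R x, of_mem x⟩ : S)) a).2

open LieAlgebra in
/-- Every map from the generators of a free Lie algebra into it extends to a derivation. -/
theorem exists_lieDerivation (d : X → FreeLieAlgebra R X) :
    ∃ D : LieDerivation R (FreeLieAlgebra R X) (FreeLieAlgebra R X), ∀ x, D (of R x) = d x := by
  let c : LieModule.Cohomology.twoCocycle R (FreeLieAlgebra R X) (FreeLieAlgebra R X) := 0
  let g : FreeLieAlgebra R X →ₗ⁅R⁆ LieAlgebra.ofTwoCocycle c :=
    lift R fun x => ofProd c (of R x, d x)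
  have hfst (a : FreeLieAlgebra R X) : ((ofProd c).symm (g a)).1 = a := by
    induction a using induction_on with
    | of_mem x => simp [g]
    | zero_mem => simp
    | add_mem a b ha hb => simp [ha, hb]
    | smul_mem t a ha => simp [ha]
    | lie_mem a b ha hb => rw [LieHom.map_lie, bracket_ofTwoCocycle]; simp [ha, hb]
  refine ⟨{ toFun := fun a => ((ofProd c).symm (g a)).2
            map_add' := fun a b => by simp
            map_smul' := fun t a => by simp
            leibniz' := fun a b => ?_ }, fun x => ?_⟩
  · simp [bracket_ofTwoCocycle, hfst, c]
  · change ((ofProd c).symm (g (of R x))).2 = d x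
    simp [g]

/-- Elimination of one generator `x₀` of a free Lie algebra: the generators `c y` are obtained from
the remaining generators `b x` by iterating `ad (b x₀)`. -/
theorem lift_injective_of_elimination {Y L : Type*} [LieRing L] [LieAlgebra R L]
    {b : X → L} {c : Y → L} {x₀ : X} {ι : ∀ x, x ≠ x₀ → Y} {s : Y → Y}
    (hι : ∀ x hx, c (ι x hx) = b x) (hs : ∀ y, c (s y) = ⁅b x₀, c y⁆)
    (ind : ∀ p : Y → Prop, (∀ x hx, p (ι x hx)) → (∀ y, p y → p (s y)) → ∀ y, p y)
    (hb : Function.Injective (lift R b)) : Function.Injective (lift R c) := by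
  classical
  obtain ⟨D, hD⟩ := exists_lieDerivation (R := R) fun y => of R (s y)
  have hg (y : Y) : ∃ u, lift R b u = c y := by
    refine ind (fun y => ∃ u, lift R b u = c y) (fun x hx => ⟨of R x, by simp [hι]⟩) ?_ y
    rintro y ⟨u, hu⟩
    exact ⟨⁅of R x₀, u⁆, by simp [hs, hu]⟩
  choose g hg using hg
  have hgι (x : X) (hx : x ≠ x₀) : g (ι x hx) = of R x := hb (by simp [hg, hι])
  have hgs (y : Y) : g (s y) = ⁅of R x₀, g y⁆ := hb (by simp [hg, hs])
  let ψ : LieDerivation R (FreeLieAlgebra R Y) (FreeLieAlgebra R Y) →ₗ⁅R⁆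
    LieDerivation R (FreeLieAlgebra R Y) (FreeLieAlgebra R Y) := LieHom.id
  let ρ : FreeLieAlgebra R X →ₗ⁅R⁆ LieAlgebra.SemiDirectSum _ _ ψ :=
    lift R fun x => if hx : x = x₀ then ⟨0, D⟩ else ⟨of R (ι x hx), 0⟩
  have hρg (y : Y) : ρ (g y) = LieAlgebra.SemiDirectSum.inl ψ (of R y) := by
    refine ind (fun y => ρ (g y) = LieAlgebra.SemiDirectSum.inl ψ (of R y))
      (fun x hx => by simp [hgι, ρ, hx]) (fun y ih => ?_) y
    rw [hgs, LieHom.map_lie, ih]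
    simp [ρ, ψ, hD]
  have hρ : ρ.comp (lift R g) = LieAlgebra.SemiDirectSum.inl ψ := by
    ext1 y
    rw [LieHom.comp_apply, lift_of_apply, hρg]
  have hbg : (lift R b).comp (lift R g) = lift R c := by
    ext1 y
    rw [LieHom.comp_apply, lift_of_apply, lift_of_apply, hg]
  have hginj : Function.Injective (lift R g) := by
    refine Function.Injective.of_comp (f := ρ) ?_
    rw [← LieHom.coe_comp, hρ]
    exact LieAlgebra.SemiDirectSum.inl_injective ψ
  rw [← hbg, LieHom.coe_comp]
  exact hb.comp hginj

theorem exists_lift_add_smul_of_elimination {Y L : Type*} [LieRing L] [LieAlgebra R L]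
    {b : X → L} {c : Y → L} {x₀ : X} {ι : ∀ x, x ≠ x₀ → Y} {s : Y → Y}
    (hι : ∀ x hx, c (ι x hx) = b x) (hs : ∀ y, c (s y) = ⁅b x₀, c y⁆) (u : FreeLieAlgebra R X) :
    ∃ (v : FreeLieAlgebra R Y) (t : R), lift R b u = lift R c v + t • b x₀ := by
  obtain ⟨D, hD⟩ := exists_lieDerivation (R := R) fun y => of R (s y)
  have had (v : FreeLieAlgebra R Y) : ⁅b x₀, lift R c v⁆ = lift R c (D v) := by
    induction v using induction_on with
    | of_mem y => simp [hD, hs]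
    | zero_mem => simp
    | add_mem v w hv hw => simp [hv, hw]
    | smul_mem t v hv => simp [hv]
    | lie_mem v w hv hw =>
      rw [LieHom.map_lie, leibniz_lie, hv, hw, LieDerivation.apply_lie_eq_add, map_add,
        LieHom.map_lie, LieHom.map_lie, add_comm]
  induction u using induction_on with
  | of_mem x =>
    by_cases hx : x = x₀
    · exact ⟨0, 1, by simp [hx]⟩
    · exact ⟨of R (ι x hx), 0, by simp [hι]⟩
  | zero_mem => exact ⟨0, 0, by simp⟩
  | add_mem u u' hu hu' =>
    obtain ⟨v, t, h⟩ := hu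
    obtain ⟨v', t', h'⟩ := hu'
    exact ⟨v + v', t + t', by rw [map_add, h, h', map_add, add_smul]; abel⟩
  | smul_mem r u hu =>
    obtain ⟨v, t, h⟩ := hu
    exact ⟨r • v, r * t, by rw [map_smul, h, map_smul, smul_add, mul_smul]⟩
  | lie_mem u u' hu hu' =>
    obtain ⟨v, t, h⟩ := hu
    obtain ⟨v', t', h'⟩ := hu'
    refine ⟨⁅v, v'⁆ + t • D v' - t' • D v, 0, ?_⟩
    rw [LieHom.map_lie, h, h']
    simp only [lie_add, add_lie, lie_smul, smul_lie, map_add, map_sub, map_smul, LieHom.map_lie,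
      ← had, lie_self, zero_smul, smul_zero, ← lie_skew (lift R c v) (b x₀)]
    module

/-- The coordinate functional of a generator vanishes on brackets. -/
theorem exists_coord [DecidableEq X] (i : X) :
    ∃ f : FreeLieAlgebra R X →ₗ[R] R,
      (∀ x y : FreeLieAlgebra R X, f ⁅x, y⁆ = 0) ∧ ∀ j, f (of R j) = if j = i then 1 else 0 := by
  let : LieRing R := LieRing.ofAssociativeRing
  let : LieAlgebra R R := LieAlgebra.ofAssociativeAlgebra
  let f : FreeLieAlgebra R X →ₗ⁅R⁆ R := lift R fun j => if j = i then 1 else 0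
  refine ⟨f, fun x y => ?_, fun j => ?_⟩
  · change f ⁅x, y⁆ = 0
    rw [LieHom.map_lie, LieRing.of_associative_ring_bracket, mul_comm, sub_self]
  · change f (of R j) = _
    simp [f]

end General

/-- The lists `(i₁,…,i_p)` with `i_p ≥ m` if `p = 1`, and `m > i₁ ≥ … ≥ i_{p-1} < i_p` otherwise:
they index the generators which remain after the first `m` generators have been eliminated. -/
def IsElimIdx {n : ℕ} : ℕ → List (Fin n) → Prop
  | _, [] => False
  | m, [i] => m ≤ i
  | m, i :: j :: l => (i : ℕ) < m ∧ IsElimIdx (i + 1) (j :: l)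

section Elimination

variable {n : ℕ} {m : ℕ}

theorem IsElimIdx.succ {l : List (Fin n)} (h : IsElimIdx m l) (hl : ∀ i : Fin n, i = m → l ≠ [i]) :
    IsElimIdx (m + 1) l := by
  match l, h with
  | [i], h =>
    simp only [IsElimIdx] at h ⊢
    have : (i : ℕ) ≠ m := fun e => hl i e rfl
    omega
  | i :: j :: l, h => exact ⟨h.1.trans (Nat.lt_succ_self m), h.2⟩

theorem IsElimIdx.cons {l : List (Fin n)} {i : Fin n} (h : IsElimIdx (i + 1) l) :
    IsElimIdx (i + 1) (i :: l) := by
  match l, h with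
  | j :: l, h => exact ⟨Nat.lt_succ_self _, h⟩

theorem nestedBracket_cons {l : List (Fin n)} (i : Fin n) (h : IsElimIdx m l) :
    nestedBracket (i :: l) = ⁅of ℝ i, nestedBracket l⁆ := by
  match l, h with
  | j :: l, _ => rfl

theorem IsElimIdx.induction_succ {m : Fin n} {p : List (Fin n) → Prop}
    (base : ∀ l, IsElimIdx m l → l ≠ [m] → p l)
    (step : ∀ l, IsElimIdx (m + 1) l → p l → p (m :: l)) :
    ∀ l, IsElimIdx (m + 1) l → p l
  | [], h => h.elim
  | [i], h => by
    simp only [IsElimIdx] at h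
    refine base _ (by simp only [IsElimIdx]; omega) ?_
    rintro ⟨⟩
    omega
  | i :: j :: l, h => by
    obtain ⟨hi, hl⟩ := h
    rcases eq_or_ne i m with rfl | hne
    · exact step _ hl (induction_succ base step _ hl)
    · have : (i : ℕ) ≠ m := Fin.val_ne_of_ne hne
      exact base _ ⟨by omega, hl⟩ (by simp)

theorem lift_nestedBracket_elimIdx (hm : m ≤ n) :
    Function.Injective (lift ℝ fun s : {l : List (Fin n) // IsElimIdx m l} => nestedBracket s.1) ∧
    ∀ z, ∃ v, ∃ t : Fin n → ℝ,
      z = lift ℝ (fun s : {l : List (Fin n) // IsElimIdx m l} => nestedBracket s.1) v +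
        ∑ i, t i • of ℝ i := by
  induction m with
  | zero =>
    let g : FreeLieAlgebra ℝ (Fin n) →ₗ⁅ℝ⁆
        FreeLieAlgebra ℝ {l : List (Fin n) // IsElimIdx 0 l} :=
      lift ℝ fun i => of ℝ ⟨[i], Nat.zero_le _⟩
    set Φ := lift ℝ fun s : {l : List (Fin n) // IsElimIdx 0 l} => nestedBracket s.1 with hΦ
    have h₁ : g.comp Φ = LieHom.id := by
      ext1 ⟨l, hl⟩
      match l, hl with
      | [i], hl => simp [g, hΦ, nestedBracket]
      | i :: j :: l, hl => exact absurd hl.1 (Nat.not_lt_zero _)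
    have h₂ : Φ.comp g = LieHom.id := by
      ext1 i
      simp [g, hΦ, nestedBracket]
    refine ⟨fun u v huv => ?_, fun z => ⟨g z, 0, ?_⟩⟩
    · rw [← LieHom.id_apply (R := ℝ) u, ← LieHom.id_apply (R := ℝ) v, ← h₁, LieHom.comp_apply,
        LieHom.comp_apply, huv]
    · simpa using (LieHom.congr_fun h₂ z).symm
  | succ m ih =>
    obtain ⟨hinj, hspan⟩ := ih (Nat.le_of_succ_le hm)
    let k : Fin n := ⟨m, hm⟩
    let x₀ : {l : List (Fin n) // IsElimIdx m l} := ⟨[k], le_rfl⟩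
    let ι (x : {l : List (Fin n) // IsElimIdx m l}) (hx : x ≠ x₀) :
        {l : List (Fin n) // IsElimIdx (m + 1) l} :=
      ⟨x.1, x.2.succ fun i hi e => hx (Subtype.ext (e.trans (by
        rw [show i = k from Fin.ext hi])))⟩
    let s (y : {l : List (Fin n) // IsElimIdx (m + 1) l}) :
        {l : List (Fin n) // IsElimIdx (m + 1) l} :=
      ⟨k :: y.1, IsElimIdx.cons (i := k) y.2⟩
    have hι : ∀ x hx, nestedBracket (ι x hx).1 = nestedBracket x.1 := fun _ _ => rfl
    have hs : ∀ y, nestedBracket (s y).1 = ⁅nestedBracket x₀.1, nestedBracket y.1⁆ :=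
      fun y => nestedBracket_cons k y.2
    have ind (p : {l : List (Fin n) // IsElimIdx (m + 1) l} → Prop) (h₁ : ∀ x hx, p (ι x hx))
        (h₂ : ∀ y, p y → p (s y)) : ∀ y, p y := by
      rintro ⟨l, hl⟩
      refine IsElimIdx.induction_succ (m := k) (p := fun l => ∀ hl, p ⟨l, hl⟩)
        (fun l hl hne _ => h₁ ⟨l, hl⟩ fun e => hne (congrArg Subtype.val e))
        (fun l hl ih _ => h₂ ⟨l, hl⟩ (ih hl)) l hl hl
    refine ⟨lift_injective_of_elimination hι hs ind hinj, fun z => ?_⟩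
    obtain ⟨u, t, rfl⟩ := hspan z
    obtain ⟨v, r, hv⟩ := exists_lift_add_smul_of_elimination (R := ℝ)
      (b := fun s : {l : List (Fin n) // IsElimIdx m l} => nestedBracket s.1)
      (c := fun s : {l : List (Fin n) // IsElimIdx (m + 1) l} => nestedBracket s.1) hι hs u
    refine ⟨v, t + Pi.single k r, ?_⟩
    have hx₀ : nestedBracket x₀.1 = of ℝ k := rfl
    rw [hv, hx₀]
    simp only [Pi.add_apply, add_smul, Finset.sum_add_distrib, Pi.single_apply, ite_smul, zero_smul,
      Finset.sum_ite_eq', Finset.mem_univ, if_true]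
    abel

theorem isElimIdx_cons_cons_iff (i j : Fin n) (l : List (Fin n)) :
    IsElimIdx m (i :: j :: l) ↔ (i : ℕ) < m ∧ IsIdxI (i :: j :: l) := by
  induction l generalizing m i j with
  | nil => simp [IsElimIdx, IsIdxI, List.Chain']
  | cons k l ih =>
    rw [IsElimIdx, ih]
    simp only [IsIdxI, List.Chain', Nat.lt_succ_iff]
    simp [List.getLast?_cons_cons, and_assoc, and_left_comm]

theorem isElimIdx_iff (l : List (Fin n)) : IsElimIdx n l ↔ IsIdxI l := by
  match l with
  | [] => simp [IsElimIdx, IsIdxI]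
  | [i] => simp [IsElimIdx, IsIdxI]
  | i :: j :: l => simp [isElimIdx_cons_cons_iff]

end Elimination

end FreeLieAlgebra

/-- The derived subalgebra `W = ⁅L, L⁆` of the free Lie algebra `L` over `ℝ` on `Z_1, …, Z_n`
is a free Lie algebra, freely generated by the right-nested brackets `B(I)`, `I ∈ ⋃_p I_{n,p}`:
the induced Lie algebra morphism `Φ` from the free Lie algebra on `⋃_p I_{n,p}` to `L` is
injective, and its image equals `W`. -/
theorem derived_subalgebra_free (n : ℕ) :
    Function.Injective
      ⇑(FreeLieAlgebra.lift ℝ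
        (fun s : {l : List (Fin n) // IsIdxI l} => nestedBracket s.1)) ∧
    Set.range
      ⇑(FreeLieAlgebra.lift ℝ
        (fun s : {l : List (Fin n) // IsIdxI l} => nestedBracket s.1)) =
      (Submodule.span ℝ {z : FreeLieAlgebra ℝ (Fin n) |
          ∃ x y : FreeLieAlgebra ℝ (Fin n), z = ⁅x, y⁆} : Set (FreeLieAlgebra ℝ (Fin n))) := by
  have hE : (IsIdxI : List (Fin n) → Prop) = FreeLieAlgebra.IsElimIdx n :=
    funext fun l => propext (FreeLieAlgebra.isElimIdx_iff l).symm
  obtain ⟨hinj, hspan⟩ : Function.Injective (FreeLieAlgebra.lift ℝ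
      fun s : {l : List (Fin n) // IsIdxI l} => nestedBracket s.1) ∧
      ∀ z, ∃ v, ∃ t : Fin n → ℝ,
        z = FreeLieAlgebra.lift ℝ (fun s : {l : List (Fin n) // IsIdxI l} => nestedBracket s.1) v +
          ∑ i, t i • FreeLieAlgebra.of ℝ i := by
    rw [hE]
    exact FreeLieAlgebra.lift_nestedBracket_elimIdx le_rfl
  refine ⟨hinj, ?_⟩
  have hsub (v : FreeLieAlgebra ℝ {l : List (Fin n) // IsIdxI l}) :
      FreeLieAlgebra.lift ℝ (fun s : {l : List (Fin n) // IsIdxI l} => nestedBracket s.1) v ∈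
        Submodule.span ℝ {z : FreeLieAlgebra ℝ (Fin n) |
          ∃ x y : FreeLieAlgebra ℝ (Fin n), z = ⁅x, y⁆} := by
    induction v using FreeLieAlgebra.induction_on with
    | of_mem s =>
      obtain ⟨l, hl⟩ := s
      rw [FreeLieAlgebra.lift_of_apply]
      match l, hl with
      | [], hl => exact absurd hl.1 (by simp)
      | [i], hl => exact absurd hl.1 (by simp)
      | i :: j :: l, _ => exact Submodule.subset_span ⟨_, _, rfl⟩
    | zero_mem => simp
    | add_mem v w hv hw => rw [map_add]; exact add_mem hv hw
    | smul_mem t v hv => rw [map_smul]; exact Submodule.smul_mem _ t hv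
    | lie_mem v w => rw [LieHom.map_lie]; exact Submodule.subset_span ⟨_, _, rfl⟩
  refine Set.Subset.antisymm (Set.range_subset_iff.2 hsub) fun w hw => ?_
  obtain ⟨v, t, rfl⟩ := hspan w
  have ht (i : Fin n) : t i = 0 := by
    obtain ⟨f, hf, hfi⟩ := FreeLieAlgebra.exists_coord (R := ℝ) i
    have hker : Submodule.span ℝ {z : FreeLieAlgebra ℝ (Fin n) |
        ∃ x y : FreeLieAlgebra ℝ (Fin n), z = ⁅x, y⁆} ≤ LinearMap.ker f := by
      rw [Submodule.span_le]
      rintro _ ⟨x, y, rfl⟩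
      exact hf x y
    have h := hker ((Submodule.add_mem_iff_right _ (hsub v)).1 hw)
    simpa [hfi] using h
  exact ⟨v, by simp [ht]⟩
end

section
/- Let L be the free Lie algebra over ℝ on generators Z_1, …, Z_n, let W = ⁅L, L⁆ be its derived subalgebra, and let ⁅W, W⁆ denote the submodule of L spanned by all brackets ⁅w, w'⁆ with w, w' ∈ W. Then for every p ≥ 3, every tuple (i₁,…,i_p) ∈ {1,…,n}^p, and every permutation σ of {1,…,p−2}, the right-nested brackets satisfy B(i₁,…,i_{p−2},i_{p−1},i_p) − B(i_{σ(1)},…,i_{σ(p−2)},i_{p−1},i_p) ∈ ⁅W, W⁆; i.e., modulo ⁅W, W⁆, a right-nested bracket is symmetric in its first p−2 entries. -/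
/-- The derived submodule `W = ⁅L, L⁆`: the span of all brackets. -/
noncomputable def derivedW (n : ℕ) : Submodule ℝ (FreeLieAlgebra ℝ (Fin n)) :=
  Submodule.span ℝ {z : FreeLieAlgebra ℝ (Fin n) |
    ∃ x y : FreeLieAlgebra ℝ (Fin n), z = ⁅x, y⁆}

/-- The submodule `⁅W, W⁆` of the free Lie algebra, where `W = ⁅L, L⁆`. -/
noncomputable abbrev derivedWW (n : ℕ) : Submodule ℝ (FreeLieAlgebra ℝ (Fin n)) :=
  Submodule.span ℝ {z : FreeLieAlgebra ℝ (Fin n) |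
    ∃ x ∈ derivedW n, ∃ y ∈ derivedW n, z = ⁅x, y⁆}

theorem lie_mem_derivedW {n : ℕ} (x y : FreeLieAlgebra ℝ (Fin n)) : ⁅x, y⁆ ∈ derivedW n :=
  Submodule.subset_span ⟨x, y, rfl⟩

theorem lie_mem_derivedWW {n : ℕ} {x y : FreeLieAlgebra ℝ (Fin n)} (hx : x ∈ derivedW n)
    (hy : y ∈ derivedW n) : ⁅x, y⁆ ∈ derivedWW n :=
  Submodule.subset_span ⟨x, hx, y, hy, rfl⟩

/-- `⁅W, W⁆` is stable under bracketing with arbitrary elements. -/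
theorem lie_mem_derivedWW_of_mem {n : ℕ} (x : FreeLieAlgebra ℝ (Fin n))
    {z : FreeLieAlgebra ℝ (Fin n)} (hz : z ∈ derivedWW n) : ⁅x, z⁆ ∈ derivedWW n := by
  induction hz using Submodule.span_induction with
  | mem z hz =>
    obtain ⟨u, hu, v, hv, rfl⟩ := hz
    rw [leibniz_lie]
    exact add_mem (lie_mem_derivedWW (lie_mem_derivedW x u) hv)
      (lie_mem_derivedWW hu (lie_mem_derivedW x v))
  | zero => rw [lie_zero]; exact zero_mem _
  | add u v _ _ hu hv => rw [lie_add]; exact add_mem hu hv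
  | smul c u _ hu => rw [lie_smul]; exact Submodule.smul_mem _ c hu

theorem nestedBracket_cons {n : ℕ} (i : Fin n) {l : List (Fin n)} (hl : l ≠ []) :
    nestedBracket (i :: l) = ⁅FreeLieAlgebra.of ℝ i, nestedBracket l⁆ := by
  cases l with
  | nil => exact absurd rfl hl
  | cons j rest => rw [nestedBracket]

theorem nestedBracket_append_pair_mem_derivedW {n : ℕ} (l : List (Fin n)) (a b : Fin n) :
    nestedBracket (l ++ [a, b]) ∈ derivedW n := by
  cases l with
  | nil =>
    rw [List.nil_append, nestedBracket_cons a (by simp)]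
    exact lie_mem_derivedW _ _
  | cons i l =>
    rw [List.cons_append, nestedBracket_cons i (by simp)]
    exact lie_mem_derivedW _ _

/-- Permuting all entries but the last two changes a right-nested bracket by an element of
`⁅W, W⁆`. -/
theorem List.Perm.nestedBracket_append_pair_sub_mem {n : ℕ} {l l' : List (Fin n)}
    (h : l.Perm l') (a b : Fin n) :
    nestedBracket (l ++ [a, b]) - nestedBracket (l' ++ [a, b]) ∈ derivedWW n := by
  induction h with
  | nil => rw [sub_self]; exact zero_mem _
  | cons i _ ih =>
    rw [List.cons_append, List.cons_append, nestedBracket_cons i (by simp),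
      nestedBracket_cons i (by simp), ← lie_sub]
    exact lie_mem_derivedWW_of_mem _ ih
  | swap i j l =>
    simp only [List.cons_append]
    rw [nestedBracket_cons j (by simp), nestedBracket_cons i (by simp),
      nestedBracket_cons i (by simp), nestedBracket_cons j (by simp), ← lie_lie]
    exact lie_mem_derivedWW (lie_mem_derivedW _ _)
      (nestedBracket_append_pair_mem_derivedW l a b)
  | trans _ _ ih₁ ih₂ =>
    rw [← sub_add_sub_cancel]
    exact add_mem ih₁ ih₂

theorem List.ofFn_add_two {α : Type*} {m : ℕ} (f : Fin (m + 2) → α) :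
    List.ofFn f = List.ofFn (fun k : Fin m => f (k.castLE (Nat.le_add_right m 2))) ++
      [f ⟨m, by omega⟩, f ⟨m + 1, by omega⟩] := by
  rw [List.ofFn_add]
  simp [Fin.natAdd, Fin.castLE]

/-- Modulo `⁅W, W⁆`, a right-nested bracket is symmetric in its first `p − 2` entries: for
`p ≥ 3`, a tuple `f : Fin p → Fin n` and a permutation `σ` of the first `p − 2` positions,
`B(f) − B(f ∘ σ) ∈ ⁅W, W⁆`. -/
theorem nested_bracket_symmetric_mod_WW (n p : ℕ) (hp : 3 ≤ p)
    (f : Fin p → Fin n) (σ : Equiv.Perm (Fin (p - 2))) :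
    nestedBracket (List.ofFn f) -
        nestedBracket (List.ofFn fun j : Fin p =>
          if h : (j : ℕ) < p - 2 then f (Fin.castLE (Nat.sub_le p 2) (σ ⟨(j : ℕ), h⟩))
          else f j) ∈
      Submodule.span ℝ {z : FreeLieAlgebra ℝ (Fin n) |
        ∃ x ∈ derivedW n, ∃ y ∈ derivedW n, z = ⁅x, y⁆} := by
  obtain ⟨m, rfl⟩ : ∃ m, p = m + 2 := ⟨p - 2, by omega⟩
  change Equiv.Perm (Fin m) at σ
  rw [List.ofFn_add_two f, List.ofFn_add_two]
  simp only [Fin.val_castLE, Nat.add_sub_cancel, Fin.is_lt, lt_irrefl,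
    Nat.not_succ_lt_self, dite_true, dite_false]
  exact (Equiv.Perm.ofFn_comp_perm σ
    (fun k : Fin m => f (k.castLE (Nat.le_add_right m 2)))).symm
    |>.nestedBracket_append_pair_sub_mem _ _
end
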